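/- For every v ∈ ℝ³ with 0 < |v| < 1: (i) the Jacobian matrix of the soliton momentum map 𝒫_s at v equals m(v), i.e., D𝒫_s(v) = m(v); and (ii) the gradient of the soliton energy satisfies ∇ℰ_s(v) = m(v)v. In particular, along any C¹ curve t ↦ u(t) with 0 < |u(t)| < 1, (d/dt)ℰ_s(u(t)) = (m(u(t))u̇(t))·u(t), which is the relation v (d𝒫_s/dv) = dℰ_s/dv. -/

import Mathlib

open Real MeasureTheory Filter
open scoped RealInnerProductSpace

noncomputable section

abbrev E3 : Type := EuclideanSpace ℝ (Fin 3)

/-- relativistic factor γ(v) = (1 - |v|²)^{-1/2} -/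
def gam (v : E3) : ℝ := (Real.sqrt (1 - ‖v‖ ^ 2))⁻¹

/-- the function appearing in the square brackets of the soliton momentum -/
def phiFun (s : ℝ) : ℝ :=
  if s = 0 then 1 / 3
  else 1 / (2 * s ^ 2 * (1 - s ^ 2)) - (1 / (4 * s ^ 3)) * Real.log ((1 + s) / (1 - s))

/-- m₀(v)w = γ w + γ³ (v·w) v -/
def m0Vec (v w : E3) : E3 := gam v • w + (gam v ^ 3 * ⟪v, w⟫) • v

/-- m_f(v)w = 3 mₑ (φ(|v|) w + |v|⁻¹ φ'(|v|)(v·w) v), equal to mₑ • w at v = 0 -/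
def mfVec (me : ℝ) (v w : E3) : E3 :=
  (3 * me * phiFun ‖v‖) • w + (3 * me * ‖v‖⁻¹ * deriv phiFun ‖v‖ * ⟪v, w⟫) • v

/-- m(v) = m₀(v) + m_f(v) -/
def mVec (me : ℝ) (v w : E3) : E3 := m0Vec v w + mfVec me v w

/-- a(v)w = (e²/12π)[γ⁴ w + 4 γ⁶ (v·w) v] -/
def aVec (e : ℝ) (v w : E3) : E3 :=
  (e ^ 2 / (12 * π)) • (gam v ^ 4 • w + (4 * gam v ^ 6 * ⟪v, w⟫) • v)

/-- b(v,w) = (e²/4π)[2γ⁶(v·w)w + γ⁶|w|²v + 6γ⁸(v·w)²v] -/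
def bVec (e : ℝ) (v w : E3) : E3 :=
  (e ^ 2 / (4 * π)) •
    ((2 * gam v ^ 6 * ⟪v, w⟫) • w + (gam v ^ 6 * ‖w‖ ^ 2) • v
      + (6 * gam v ^ 8 * ⟪v, w⟫ ^ 2) • v)

/-- soliton energy ℰ_s(v), extended by ℰ_s(0) = 0 -/
def Es (me : ℝ) (v : E3) : ℝ :=
  if ‖v‖ = 0 then 0
  else gam v - 1 + 3 * me * ((2 - ‖v‖ ^ 2) / (2 * (1 - ‖v‖ ^ 2))
    - (1 / (2 * ‖v‖)) * Real.log ((1 + ‖v‖) / (1 - ‖v‖)))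

/-- m(v) as a continuous linear map:
m(v)w = (γ + 3mₑφ(|v|)) w + (γ³ + 3mₑ|v|⁻¹φ'(|v|)) (v·w) v -/
def mCLM (me : ℝ) (v : E3) : E3 →L[ℝ] E3 :=
  (gam v + 3 * me * phiFun ‖v‖) • ContinuousLinearMap.id ℝ E3
    + (gam v ^ 3 + 3 * me * ‖v‖⁻¹ * deriv phiFun ‖v‖) • (innerSL ℝ v).smulRight v

/-- the soliton momentum 𝒫_s(v) = γ(v)v + 3mₑφ(|v|)v -/
def Ps (me : ℝ) (v : E3) : E3 := gam v • v + (3 * me * phiFun ‖v‖) • v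

theorem hasFDerivAt_norm_of_ne_zero {F : Type*} [NormedAddCommGroup F] [InnerProductSpace ℝ F]
    {v : F} (hv : v ≠ 0) : HasFDerivAt (fun x : F => ‖x‖) (‖v‖⁻¹ • innerSL ℝ v) v := by
  have h := (hasStrictFDerivAt_norm_sq v).hasFDerivAt.sqrt (pow_ne_zero 2 (norm_ne_zero_iff.2 hv))
  simp only [Real.sqrt_sq (norm_nonneg _)] at h
  refine h.congr_fderiv ?_
  ext w
  simp
  ring

theorem HasDerivAt.hasFDerivAt_comp_norm {F : Type*} [NormedAddCommGroup F]
    [InnerProductSpace ℝ F] {f : ℝ → ℝ} {d : ℝ} {v : F} (hf : HasDerivAt f d ‖v‖) (hv : v ≠ 0) :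
    HasFDerivAt (fun x : F => f ‖x‖) ((d * ‖v‖⁻¹) • innerSL ℝ v) v := by
  refine (hf.comp_hasFDerivAt v (hasFDerivAt_norm_of_ne_zero hv)).congr_fderiv ?_
  rw [smul_smul]

theorem one_sub_sq_pos_of_mem_Ioo {s : ℝ} (h0 : 0 < s) (h1 : s < 1) : 0 < 1 - s ^ 2 := by
  nlinarith

theorem hasDerivAt_inv_sqrt_one_sub_sq {s : ℝ} (h0 : 0 < s) (h1 : s < 1) :
    HasDerivAt (fun x : ℝ => (√(1 - x ^ 2))⁻¹) (s * (√(1 - s ^ 2))⁻¹ ^ 3) s := by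
  have hp := one_sub_sq_pos_of_mem_Ioo h0 h1
  have hq : √(1 - s ^ 2) ≠ 0 := (Real.sqrt_pos.2 hp).ne'
  have h := ((((hasDerivAt_id s).fun_pow 2).const_sub 1).sqrt hp.ne').fun_inv hq
  refine h.congr_deriv ?_
  simp only [id]
  field_simp
  norm_num

theorem hasDerivAt_log_one_add_div_one_sub {s : ℝ} (h0 : 0 < s) (h1 : s < 1) :
    HasDerivAt (fun x : ℝ => Real.log ((1 + x) / (1 - x))) (2 / (1 - s ^ 2)) s := by
  have ha : 1 + s ≠ 0 := by linarith
  have hb : 1 - s ≠ 0 := by linarith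
  have hp := (one_sub_sq_pos_of_mem_Ioo h0 h1).ne'
  have h := (((hasDerivAt_id s).const_add 1).fun_div ((hasDerivAt_id s).const_sub 1) hb).log
    (div_ne_zero ha hb)
  refine h.congr_deriv ?_
  simp only [id]
  field_simp
  ring

theorem hasDerivAt_phiFun {s : ℝ} (h0 : 0 < s) (h1 : s < 1) :
    HasDerivAt phiFun
      (-(1 - 2 * s ^ 2) / (s ^ 3 * (1 - s ^ 2) ^ 2) - 1 / (2 * s ^ 3 * (1 - s ^ 2))
        + 3 / (4 * s ^ 4) * Real.log ((1 + s) / (1 - s))) s := by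
  have hp := (one_sub_sq_pos_of_mem_Ioo h0 h1).ne'
  have hs := h0.ne'
  have hx := hasDerivAt_id' s
  have hA := (hasDerivAt_const s (1 : ℝ)).fun_div
    (((hx.fun_pow 2).const_mul 2).fun_mul ((hx.fun_pow 2).const_sub 1))
    (mul_ne_zero (mul_ne_zero two_ne_zero (pow_ne_zero 2 hs)) hp)
  have hB := ((hasDerivAt_const s (1 : ℝ)).fun_div ((hx.fun_pow 3).const_mul 4)
    (mul_ne_zero four_ne_zero (pow_ne_zero 3 hs))).fun_mul
    (hasDerivAt_log_one_add_div_one_sub h0 h1)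
  refine ((hA.fun_sub hB).congr_of_eventuallyEq ?_).congr_deriv ?_
  · filter_upwards [lt_mem_nhds h0] with x hx
    simp [phiFun, hx.ne']
  · field_simp
    ring

theorem hasDerivAt_field_energy {s : ℝ} (h0 : 0 < s) (h1 : s < 1) :
    HasDerivAt (fun x : ℝ => (2 - x ^ 2) / (2 * (1 - x ^ 2))
        - (1 / (2 * x)) * Real.log ((1 + x) / (1 - x)))
      (s * (phiFun s + s * deriv phiFun s)) s := by
  have hp := (one_sub_sq_pos_of_mem_Ioo h0 h1).ne'
  have hs := h0.ne'
  have hx := hasDerivAt_id' s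
  have hA := ((hx.fun_pow 2).const_sub 2).fun_div (((hx.fun_pow 2).const_sub 1).const_mul 2)
    (mul_ne_zero two_ne_zero hp)
  have hB := ((hasDerivAt_const s (1 : ℝ)).fun_div (hx.const_mul 2)
    (mul_ne_zero two_ne_zero hs)).fun_mul (hasDerivAt_log_one_add_div_one_sub h0 h1)
  refine (hA.fun_sub hB).congr_deriv ?_
  rw [(hasDerivAt_phiFun h0 h1).deriv, phiFun, if_neg hs]
  field_simp
  ring

theorem gam_pow_three_eq {v : E3} (h1 : ‖v‖ < 1) : gam v ^ 3 = gam v + gam v ^ 3 * ‖v‖ ^ 2 := by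
  have hp : 0 < 1 - ‖v‖ ^ 2 := by nlinarith [norm_nonneg v]
  have hq : √(1 - ‖v‖ ^ 2) ≠ 0 := (Real.sqrt_pos.2 hp).ne'
  have hsq : √(1 - ‖v‖ ^ 2) ^ 2 = 1 - ‖v‖ ^ 2 := Real.sq_sqrt hp.le
  unfold gam
  field_simp
  linarith

theorem hasFDerivAt_Ps (me : ℝ) {v : E3} (h0 : 0 < ‖v‖) (h1 : ‖v‖ < 1) :
    HasFDerivAt (Ps me) (mCLM me v) v := by
  have hv : v ≠ 0 := norm_pos_iff.1 h0
  have hd : HasDerivAt phiFun (deriv phiFun ‖v‖) ‖v‖ :=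
    (hasDerivAt_phiFun h0 h1).differentiableAt.hasDerivAt
  have hg := (hasDerivAt_inv_sqrt_one_sub_sq h0 h1).hasFDerivAt_comp_norm hv
  have hf := (hd.const_mul (3 * me)).hasFDerivAt_comp_norm hv
  refine ((hg.fun_smul (hasFDerivAt_id v)).fun_add
    (hf.fun_smul (hasFDerivAt_id v))).congr_fderiv ?_
  ext1 w
  simp only [mCLM, gam, add_apply, smul_apply, ContinuousLinearMap.smulRight_apply,
    ContinuousLinearMap.id_apply, id, innerSL_apply_apply, smul_eq_mul]
  match_scalars <;> field_simp

theorem hasGradientAt_Es (me : ℝ) {v : E3} (h0 : 0 < ‖v‖) (h1 : ‖v‖ < 1) :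
    HasGradientAt (Es me) (mCLM me v v) v := by
  have hv : v ≠ 0 := norm_pos_iff.1 h0
  have h := (((hasDerivAt_inv_sqrt_one_sub_sq h0 h1).sub_const 1).fun_add
    ((hasDerivAt_field_energy h0 h1).const_mul (3 * me))).hasFDerivAt_comp_norm hv
  rw [hasGradientAt_iff_hasFDerivAt]
  refine (h.congr_of_eventuallyEq ?_).congr_fderiv ?_
  · filter_upwards [isOpen_ne.mem_nhds hv] with x hx
    simp [Es, gam, hx]
  · ext1 w
    have hgam := gam_pow_three_eq h1
    simp only [mCLM, add_apply, smul_apply, ContinuousLinearMap.smulRight_apply,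
      ContinuousLinearMap.id_apply, innerSL_apply_apply, smul_eq_mul,
      InnerProductSpace.toDual_apply_apply, inner_add_left, real_inner_smul_left,
      real_inner_self_eq_norm_sq]
    change (‖v‖ * gam v ^ 3 + _) * _ * _ = _
    field_simp
    linear_combination ⟪v, w⟫ * hgam

theorem inner_mCLM_comm (me : ℝ) (v w : E3) : ⟪mCLM me v v, w⟫ = ⟪mCLM me v w, v⟫ := by
  simp only [mCLM, add_apply, smul_apply, ContinuousLinearMap.smulRight_apply,
    ContinuousLinearMap.id_apply, innerSL_apply_apply,
    inner_add_left, real_inner_smul_left, real_inner_comm v w]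
  ring

/-- for 0 < |v| < 1, D𝒫_s(v) = m(v) and ∇ℰ_s(v) = m(v)v; in particular,
along any C¹ curve u with 0 < |u(t)| < 1, (d/dt)ℰ_s(u(t)) = (m(u)u̇)·u. -/
theorem soliton_momentum_energy_derivatives
    (me : ℝ) (hme : 0 ≤ me) :
    (∀ v : E3, 0 < ‖v‖ → ‖v‖ < 1 →
      HasFDerivAt (Ps me) (mCLM me v) v ∧ gradient (Es me) v = mCLM me v v)
    ∧ ∀ (u u' : ℝ → E3), (∀ t : ℝ, HasDerivAt u (u' t) t) →
        (∀ t : ℝ, 0 < ‖u t‖ ∧ ‖u t‖ < 1) →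
        ∀ t : ℝ, HasDerivAt (fun s => Es me (u s)) ⟪mCLM me (u t) (u' t), u t⟫ t := by
  refine ⟨fun v h0 h1 => ⟨hasFDerivAt_Ps me h0 h1, (hasGradientAt_Es me h0 h1).gradient⟩, ?_⟩
  intro u u' hu hn t
  have h := (hasGradientAt_Es me (hn t).1 (hn t).2).hasFDerivAt.comp_hasDerivAt t (hu t)
  refine h.congr_deriv ?_
  rw [InnerProductSpace.toDual_apply_apply, inner_mCLM_comm]
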